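/- arXiv:2302.07542 — 2 statements merged into one kernel-verified Lean document; each statement's English description precedes it below -/
import Mathlib

section
/- (DFE of novel mutations is skewed to negative coefficients.) In the multi-locus Wright–Fisher graph setup with integer N satisfying N ≥ 2 and N ≥ 4C² where C = max_{j,u,v} |γ^j_{uv}|, for every real c < 0 one has ∑_{j=1}^L ∑_{u,v∈V} (η^j_u/Ω^j_N) θ_{uv} · 1{γ^j_{uv} = c} ≥ ∑_{j=1}^L ∑_{u,v∈V} (η^j_u/Ω^j_N) θ_{uv} · 1{γ^j_{uv} = −c}; that is, the weight assigned by the distribution of fitness effects H_dfe to any negative selection coefficient is at least the weight assigned to its positive counterpart. -/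
/-- Scaled fixation factor: `ω_γ = 2γ/(1 − e^{−2γ})` for `γ ≠ 0`, and `ω_0 = 1`. -/
noncomputable def omegaSel (γ : ℝ) : ℝ :=
  if γ = 0 then 1 else 2 * γ / (1 - Real.exp (-2 * γ))

/-- `K_γ = ω_γ ∫_0^1 (−ln y)(e^{−2γy} − e^{−2γ(1−y)}) dy`. -/
noncomputable def Ksel (γ : ℝ) : ℝ :=
  omegaSel γ *
    ∫ y in (0:ℝ)..1, (-Real.log y) * (Real.exp (-2 * γ * y) - Real.exp (-2 * γ * (1 - y)))

lemma omega_pos (γ : ℝ) : 0 < omegaSel γ := by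
  unfold omegaSel
  split_ifs with h
  · norm_num
  · rcases lt_or_gt_of_ne h with h | h
    · have : 1 < Real.exp (-2 * γ) := by
        rw [Real.one_lt_exp_iff]; linarith
      exact div_pos_of_neg_of_neg (by linarith) (by linarith)
    · have : Real.exp (-2 * γ) < 1 := by
        rw [Real.exp_lt_one_iff]; linarith
      exact div_pos (by linarith) (by linarith)

lemma omega_neg (γ : ℝ) : omegaSel γ = Real.exp (2 * γ) * omegaSel (-γ) := by
  unfold omegaSel
  by_cases h : γ = 0
  · simp [h]
  · have h' : -γ ≠ 0 := neg_ne_zero.mpr h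
    rw [if_neg h, if_neg h']
    have e : Real.exp (-2 * γ) = (Real.exp (2 * γ))⁻¹ := by
      rw [← Real.exp_neg]; ring_nf
    have e2 : -2 * -γ = 2 * γ := by ring
    rw [e, e2]
    have hp := Real.exp_pos (2 * γ)
    have hne : Real.exp (2 * γ) ≠ 1 := by
      intro hh; rw [Real.exp_eq_one_iff] at hh; exact h (by linarith)
    have h1 : Real.exp (2 * γ) - 1 ≠ 0 := sub_ne_zero.mpr hne
    have h2 : 1 - Real.exp (2 * γ) ≠ 0 := sub_ne_zero.mpr hne.symm
    have h3 : 1 - (Real.exp (2 * γ))⁻¹ ≠ 0 := by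
      intro hh; apply h1; field_simp at hh; linarith
    rw [div_eq_iff h3]
    field_simp
    ring

lemma omega_le_pos (γ N : ℝ) (h : 0 ≤ γ) (hN : 2 ≤ N) (hN2 : 4 * γ ^ 2 ≤ N) :
    omegaSel γ ≤ N := by
  rcases h.eq_or_lt with rfl | h
  · simp [omegaSel]; linarith
  · unfold omegaSel
    rw [if_neg h.ne']
    have hq := Real.quadratic_le_exp_of_nonneg (x := 2 * γ) (by linarith)
    have e : Real.exp (-2 * γ) = (Real.exp (2 * γ))⁻¹ := by
      rw [← Real.exp_neg]; ring_nf
    have hp := Real.exp_pos (2 * γ)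
    have hlt : Real.exp (-2 * γ) < 1 := by
      rw [Real.exp_lt_one_iff]; linarith
    rw [div_le_iff₀ (by linarith)]
    have h4 : Real.exp (-2 * γ) ≤ (1 + 2 * γ + (2 * γ) ^ 2 / 2)⁻¹ := by
      rw [e]; exact inv_anti₀ (by positivity) hq
    have h5 : 2 * γ ≤ N * (1 - (1 + 2 * γ + (2 * γ) ^ 2 / 2)⁻¹) := by
      have hD : 0 < 1 + 2 * γ + (2 * γ) ^ 2 / 2 := by positivity
      have : N * (1 - (1 + 2 * γ + (2 * γ) ^ 2 / 2)⁻¹)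
          = N * (2 * γ + (2 * γ) ^ 2 / 2) / (1 + 2 * γ + (2 * γ) ^ 2 / 2) := by
        field_simp; ring
      rw [this, le_div_iff₀ hD]
      have h6 : 1 + 2 * γ + (2 * γ) ^ 2 / 2 ≤ N * (1 + γ) := by nlinarith
      nlinarith
    nlinarith

lemma q_le (γ N y : ℝ) (hN : 2 ≤ N) (hN2 : 4 * γ ^ 2 ≤ N) (hy0 : 0 ≤ y) (hy1 : y ≤ 1) :
    omegaSel γ * Real.exp (-2 * γ * (1 - y)) ≤ N := by
  rcases le_total 0 γ with h | h
  · have h1 : Real.exp (-2 * γ * (1 - y)) ≤ 1 := by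
      rw [Real.exp_le_one_iff]; nlinarith
    have := omega_le_pos γ N h hN hN2
    have := omega_pos γ
    nlinarith
  · have h1 := omega_le_pos (-γ) N (by linarith) hN (by simpa using hN2)
    rw [omega_neg γ]
    have h2 : Real.exp (2 * γ) * Real.exp (-2 * γ * (1 - y)) ≤ 1 := by
      rw [← Real.exp_add, Real.exp_le_one_iff]; nlinarith
    have := omega_pos (-γ)
    nlinarith

lemma q_int (γ : ℝ) :
    ∫ y in (0:ℝ)..1, omegaSel γ * Real.exp (-2 * γ * (1 - y)) = 1 := by
  by_cases h : γ = 0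
  · simp [h, omegaSel]
  · have hd : ∀ y ∈ Set.uIcc (0:ℝ) 1, HasDerivAt
        (fun y => omegaSel γ * (Real.exp (-2 * γ * (1 - y)) / (2 * γ)))
        (omegaSel γ * Real.exp (-2 * γ * (1 - y))) y := by
      intro y _
      have h1 : HasDerivAt (fun y : ℝ => -2 * γ * (1 - y)) (2 * γ) y := by
        have := ((hasDerivAt_id y).const_sub 1).const_mul (-2 * γ)
        simpa using this
      have := (h1.exp.div_const (2 * γ)).const_mul (omegaSel γ)
      rw [mul_div_assoc, div_self (by simpa using h), mul_one] at this
      exact this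
    rw [intervalIntegral.integral_eq_sub_of_hasDerivAt hd
      (Continuous.intervalIntegrable (by fun_prop) _ _)]
    have h2 : (1 - Real.exp (-2 * γ)) ≠ 0 := by
      intro hh
      have : Real.exp (-2 * γ) = 1 := by linarith
      rw [Real.exp_eq_one_iff] at this; exact h (by linarith)
    unfold omegaSel
    rw [if_neg h]
    simp only [sub_self, mul_zero, Real.exp_zero, sub_zero, mul_one]
    rw [← mul_sub, ← sub_div, div_mul_div_comm, mul_comm, div_self]
    exact mul_ne_zero h2 (by simpa using h)

lemma K_bound (γ N : ℝ) (hN : 2 ≤ N) (hN2 : 4 * γ ^ 2 ≤ N) :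
    0 ≤ 1 + Real.log N + Ksel γ := by
  have hN0 : 0 < N := by linarith
  have hw := omega_pos γ
  set q : ℝ → ℝ := fun y => omegaSel γ * Real.exp (-2 * γ * (1 - y)) with hq
  have hqc : Continuous q := by fun_prop
  have hq0 : ∀ y, 0 ≤ q y := fun y => by positivity
  have hlog : ∀ a b : ℝ, IntervalIntegrable Real.log MeasureTheory.volume a b :=
    fun a b => intervalIntegral.intervalIntegrable_log'
  have hg : ∀ (g : ℝ → ℝ), Continuous g → ∀ a b : ℝ,
      IntervalIntegrable (fun y => Real.log y * g y) MeasureTheory.volume a b :=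
    fun g hg a b => (hlog a b).mul_continuousOn hg.continuousOn
  -- main estimate
  have hf : ∀ a b : ℝ, IntervalIntegrable (fun y => -(Real.log N * q y + Real.log y * q y))
      MeasureTheory.volume a b := fun a b =>
    (((hqc.const_mul _).intervalIntegrable a b).add (hg q hqc a b)).neg
  have hinv1 : 1 / N ≤ 1 := by rw [div_le_one hN0]; linarith
  have hinv0 : 0 < 1 / N := by positivity
  have hA : ∫ y in (0:ℝ)..(1 / N), -(Real.log N * q y + Real.log y * q y) ≤ 1 := by
    have h1 : ∫ y in (0:ℝ)..(1 / N), -(Real.log N * q y + Real.log y * q y)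
        ≤ ∫ y in (0:ℝ)..(1 / N), -N * (Real.log N + Real.log y) := by
      apply intervalIntegral.integral_mono_on_of_le_Ioo hinv0.le (hf _ _)
      · exact ((intervalIntegrable_const).add (hlog _ _)).const_mul _
      · intro y hy
        have hl : Real.log N + Real.log y ≤ 0 := by
          rw [← Real.log_mul hN0.ne' hy.1.ne']
          apply Real.log_nonpos (by have := hy.1; positivity)
          have := hy.2
          rw [lt_div_iff₀ hN0] at this
          linarith
        have := q_le γ N y hN hN2 hy.1.le (hy.2.le.trans hinv1)
        have h3 : q y ≤ N := this
        nlinarith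
    refine h1.trans (le_of_eq ?_)
    rw [intervalIntegral.integral_const_mul, intervalIntegral.integral_add
      intervalIntegrable_const (hlog _ _), integral_log]
    simp
    field_simp
    ring
  have hB : ∫ y in (1 / N)..1, -(Real.log N * q y + Real.log y * q y) ≤ 0 := by
    have h1 : ∫ y in (1 / N)..1, -(Real.log N * q y + Real.log y * q y)
        ≤ ∫ y in (1 / N)..1, (0:ℝ) := by
      apply intervalIntegral.integral_mono_on_of_le_Ioo hinv1 (hf _ _)
      · exact intervalIntegrable_const
      · intro y hy
        have hy0 : 0 < y := hinv0.trans hy.1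
        have hl : 0 ≤ Real.log N + Real.log y := by
          rw [← Real.log_mul hN0.ne' hy0.ne']
          apply Real.log_nonneg
          have := hy.1
          rw [div_lt_iff₀ hN0] at this
          linarith
        have := hq0 y
        nlinarith
    simpa using h1
  have hAB : ∫ y in (0:ℝ)..1, -(Real.log N * q y + Real.log y * q y) ≤ 1 := by
    rw [← intervalIntegral.integral_add_adjacent_intervals (hf 0 (1 / N)) (hf (1 / N) 1)]
    linarith
  rw [intervalIntegral.integral_neg, intervalIntegral.integral_add
    ((hqc.const_mul _).intervalIntegrable _ _) (hg q hqc _ _),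
    intervalIntegral.integral_const_mul] at hAB
  have hqi : ∫ y in (0:ℝ)..1, q y = 1 := q_int γ
  rw [hqi] at hAB
  have hK : ∫ y in (0:ℝ)..1, Real.log y * q y ≤ Ksel γ := by
    unfold Ksel
    rw [← intervalIntegral.integral_const_mul]
    apply intervalIntegral.integral_mono_on_of_le_Ioo zero_le_one (hg q hqc _ _)
    · have := hg (fun y => -omegaSel γ *
        (Real.exp (-2 * γ * y) - Real.exp (-2 * γ * (1 - y)))) (by fun_prop) 0 1
      refine this.congr ?_
      intro y _
      simp only
      ring
    · intro y hy
      have hl : Real.log y ≤ 0 := Real.log_nonpos hy.1.le hy.2.le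
      have : 0 ≤ omegaSel γ * Real.exp (-2 * γ * y) := by positivity
      simp only [hq]
      nlinarith
  linarith

/-- The DFE of novel mutations is skewed to negative selection coefficients: for `c < 0`,
the weight at `-c` is at most the weight at `c`. -/
theorem dfe_skewed_negative {V : Type*} [Fintype V]
    (L N : ℕ) (hL : 1 ≤ L) (hN : 2 ≤ N)
    (θ : V → V → ℝ) (hθ : ∀ u v, 0 ≤ θ u v) (hθdiag : ∀ u, θ u u = 0)
    (γ : Fin L → V → V → ℝ) (hγ : ∀ j u v, γ j u v = -γ j v u)
    (η : Fin L → V → ℝ) (hη0 : ∀ j u, 0 ≤ η j u) (hη1 : ∀ j, ∑ u, η j u = 1)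
    (hdb : ∀ j u v,
      η j u * θ u v * omegaSel (γ j u v) = η j v * θ v u * omegaSel (γ j v u))
    (C : ℝ) (hC : ∀ j u v, |γ j u v| ≤ C) (hNC : 4 * C ^ 2 ≤ (N : ℝ))
    (Ω : Fin L → ℝ)
    (hΩ : ∀ j, Ω j = 1 + (2 / L) *
      ∑ u, ∑ v, η j u * θ u v * (1 + Real.log N + Ksel (γ j u v)))
    (c : ℝ) (hc : c < 0) :
    (∑ j, ∑ u, ∑ v, (η j u / Ω j) * θ u v * (if γ j u v = -c then (1:ℝ) else 0))
      ≤ ∑ j, ∑ u, ∑ v, (η j u / Ω j) * θ u v * (if γ j u v = c then (1:ℝ) else 0) := by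
  have hΩpos : ∀ j, 0 < Ω j := by
    intro j
    rw [hΩ]
    have : 0 ≤ ∑ u, ∑ v, η j u * θ u v * (1 + Real.log N + Ksel (γ j u v)) := by
      refine Finset.sum_nonneg fun u _ => Finset.sum_nonneg fun v _ => ?_
      refine mul_nonneg (mul_nonneg (hη0 j u) (hθ u v)) (K_bound _ _ (by exact_mod_cast hN) ?_)
      have h1 := hC j u v
      have h2 : (γ j u v) ^ 2 ≤ C ^ 2 := by
        rw [← sq_abs]
        exact pow_le_pow_left₀ (abs_nonneg _) h1 2
      linarith
    positivity
  refine Finset.sum_le_sum fun j _ => ?_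
  rw [Finset.sum_comm (f := fun u v => (η j u / Ω j) * θ u v * (if γ j u v = c then (1:ℝ) else 0))]
  refine Finset.sum_le_sum fun u _ => Finset.sum_le_sum fun v _ => ?_
  have hg := hγ j u v
  by_cases h : γ j u v = -c
  · have h' : γ j v u = c := by linarith
    rw [if_pos h, if_pos h', mul_one, mul_one, div_mul_eq_mul_div, div_mul_eq_mul_div]
    refine div_le_div_of_nonneg_right ?_ (hΩpos j).le
    have hd := hdb j u v
    rw [h, h', omega_neg (-c), neg_neg] at hd
    have hw := omega_pos c
    have he : 1 ≤ Real.exp (2 * -c) := by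
      rw [Real.one_le_exp_iff]; linarith
    have hd2 : η j u * θ u v * Real.exp (2 * -c) = η j v * θ v u :=
      mul_right_cancel₀ hw.ne' (by rw [← hd]; ring)
    have h0 := mul_nonneg (hη0 j u) (hθ u v)
    nlinarith
  · have h' : ¬ γ j v u = c := by
      intro hh; apply h; linarith
    rw [if_neg h, if_neg h']
    simp
end

section
/- (Average selection load of novel mutations is deleterious.) In the multi-locus Wright–Fisher graph setup with integer N satisfying N ≥ 2 and N ≥ 4C² where C = max_{j,u,v} |γ^j_{uv}|, one has ∑_{j=1}^L ∑_{u,v∈V} (η^j_u/Ω^j_N) θ_{uv} γ^j_{uv} ≤ 0; that is, the mean selection coefficient γ̂ of the distribution of fitness effects of novel mutations is nonpositive. -/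
lemma aux_ii (a b : ℝ) (f : ℝ → ℝ) (hf : Continuous f) (k : ℝ) :
    IntervalIntegrable (fun y => (-Real.log y - k) * f y) MeasureTheory.volume a b := by
  have h : IntervalIntegrable (fun y => -Real.log y - k) MeasureTheory.volume a b :=
    (intervalIntegral.intervalIntegrable_log').neg.sub intervalIntegrable_const
  exact h.mul_continuousOn hf.continuousOn

lemma aux_int (d k M : ℝ) :
    ∫ y in (0:ℝ)..d, (-Real.log y - k) * M = (d - d * Real.log d - k * d) * M := by
  have hi : IntervalIntegrable (fun y => -Real.log y) MeasureTheory.volume 0 d :=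
    (intervalIntegral.intervalIntegrable_log').neg
  rw [intervalIntegral.integral_mul_const, intervalIntegral.integral_sub
    hi intervalIntegrable_const,
    intervalIntegral.integral_neg, integral_log]
  simp
  left
  ring

lemma aux_w (c : ℝ) (hc : c ≠ 0) :
    ∫ y in (0:ℝ)..1, Real.exp (-c * (1 - y)) = (1 - Real.exp (-c)) / c := by
  have : ∀ y ∈ Set.uIcc (0:ℝ) 1, HasDerivAt (fun y => Real.exp (-c * (1 - y)) / c)
      (Real.exp (-c * (1 - y))) y := by
    intro y _
    have h1 : HasDerivAt (fun y : ℝ => -c * (1 - y)) c y := by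
      have := ((hasDerivAt_id y).const_sub 1).const_mul (-c)
      simpa using this
    have := h1.exp.div_const c
    rwa [mul_div_assoc, div_self hc, mul_one] at this
  rw [intervalIntegral.integral_eq_sub_of_hasDerivAt this
    (Continuous.intervalIntegrable (by fun_prop) _ _)]
  simp
  ring

lemma aux_num (b N : ℝ) (hb : 0 < b) (h2 : 2 ≤ N) (hbN : b ^ 2 ≤ N) :
    Real.exp b / N ≤ (Real.exp b - 1) / b := by
  have he := Real.quadratic_le_exp_of_nonneg hb.le
  rw [div_le_div_iff₀ (by linarith) hb]
  have h3 : 1 + b + b ^ 2 / 2 ≤ N * (1 + b / 2) := by nlinarith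
  have h4 : 0 ≤ N - b := by nlinarith [sq_nonneg (b - 1)]
  nlinarith [mul_le_mul_of_nonneg_left he h4, mul_le_mul_of_nonneg_left h3 hb.le]

lemma aux_J (c N : ℝ) (h2 : 2 ≤ N) (hcN : c ^ 2 ≤ N) :
    ∫ y in (0:ℝ)..1, (-Real.log y) * Real.exp (-c * (1 - y)) ≤
      (1 + Real.log N) * ∫ y in (0:ℝ)..1, Real.exp (-c * (1 - y)) := by
  have hw : Continuous (fun y : ℝ => Real.exp (-c * (1 - y))) := by fun_prop
  have hN0 : 0 < N := by linarith
  have hlN : 0 ≤ Real.log N := Real.log_nonneg (by linarith)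
  have hWi : IntervalIntegrable (fun y : ℝ => Real.exp (-c * (1 - y))) MeasureTheory.volume 0 1 :=
    hw.intervalIntegrable _ _
  have hW0 : 0 ≤ ∫ y in (0:ℝ)..1, Real.exp (-c * (1 - y)) :=
    intervalIntegral.integral_nonneg zero_le_one (fun _ _ => (Real.exp_pos _).le)
  have key : ∀ k : ℝ, ∫ y in (0:ℝ)..1, (-Real.log y) * Real.exp (-c * (1 - y)) =
      (∫ y in (0:ℝ)..1, (-Real.log y - k) * Real.exp (-c * (1 - y))) +
      k * ∫ y in (0:ℝ)..1, Real.exp (-c * (1 - y)) := by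
    intro k
    rw [← intervalIntegral.integral_const_mul, ← intervalIntegral.integral_add
      (aux_ii _ _ _ hw _) (hWi.const_mul k)]
    congr 1
    ext y
    ring
  rcases le_or_gt 0 c with hc | hc
  · rw [key 1]
    have h1 : ∫ y in (0:ℝ)..1, (-Real.log y - 1) * Real.exp (-c * (1 - y)) ≤
        ∫ y in (0:ℝ)..1, (-Real.log y - 1) * Real.exp (-c * (1 - Real.exp (-1))) := by
      refine intervalIntegral.integral_mono_on_of_le_Ioo zero_le_one (aux_ii _ _ _ hw _)
        (aux_ii _ _ _ continuous_const _) ?_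
      rintro y ⟨hy0, hy1⟩
      rcases le_total y (Real.exp (-1)) with h | h
      · have := (Real.log_le_iff_le_exp hy0).2 h
        refine mul_le_mul_of_nonneg_left (Real.exp_le_exp.2 ?_) (by linarith)
        nlinarith
      · have := (Real.le_log_iff_exp_le hy0).2 h
        refine mul_le_mul_of_nonpos_left (Real.exp_le_exp.2 ?_) (by linarith)
        nlinarith
    rw [aux_int] at h1
    simp at h1
    simp only [neg_mul] at *
    nlinarith
  · rw [key (Real.log N)]
    have hNi : (0:ℝ) < N⁻¹ := by positivity
    have hNi1 : N⁻¹ ≤ 1 := inv_le_one_of_one_le₀ (by linarith)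
    have h1 : ∫ y in (0:ℝ)..N⁻¹, (-Real.log y - Real.log N) * Real.exp (-c * (1 - y)) ≤
        ∫ y in (0:ℝ)..N⁻¹, (-Real.log y - Real.log N) * Real.exp (-c) := by
      refine intervalIntegral.integral_mono_on_of_le_Ioo hNi.le (aux_ii _ _ _ hw _)
        (aux_ii _ _ _ continuous_const _) ?_
      rintro y ⟨hy0, hy1⟩
      have := Real.log_le_log hy0 hy1.le
      rw [Real.log_inv] at this
      refine mul_le_mul_of_nonneg_left (Real.exp_le_exp.2 ?_) (by linarith)
      nlinarith
    have h2' : ∫ y in N⁻¹..(1:ℝ), (-Real.log y - Real.log N) * Real.exp (-c * (1 - y)) ≤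
        ∫ y in N⁻¹..(1:ℝ), (0:ℝ) := by
      refine intervalIntegral.integral_mono_on_of_le_Ioo hNi1 (aux_ii _ _ _ hw _)
        intervalIntegrable_const ?_
      rintro y ⟨hy0, hy1⟩
      have := Real.log_le_log hNi hy0.le
      rw [Real.log_inv] at this
      exact mul_nonpos_of_nonpos_of_nonneg (by linarith) (Real.exp_pos _).le
    have h3 := intervalIntegral.integral_add_adjacent_intervals
      (aux_ii 0 N⁻¹ _ hw (Real.log N)) (aux_ii N⁻¹ 1 _ hw (Real.log N))
    rw [aux_int, Real.log_inv] at h1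
    rw [intervalIntegral.integral_zero] at h2'
    have h4 := aux_num (-c) N (by linarith) h2 (by linarith [neg_sq c])
    have h5 : (Real.exp (-c) - 1) / (-c) = ∫ y in (0:ℝ)..1, Real.exp (-c * (1 - y)) := by
      rw [aux_w c hc.ne, div_neg, ← neg_div]; ring
    rw [← h3, add_mul, one_mul, ← h5]
    have h6 : (N⁻¹ - N⁻¹ * -Real.log N - Real.log N * N⁻¹) * Real.exp (-c) = Real.exp (-c) / N := by
      ring
    linarith

lemma aux_omega (g : ℝ) :
    omegaSel g * ∫ y in (0:ℝ)..1, Real.exp (-(2 * g) * (1 - y)) = 1 := by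
  unfold omegaSel
  split_ifs with h
  · simp [h]
  · rw [aux_w _ (by simpa using h)]
    have h1 : 1 - Real.exp (-2 * g) ≠ 0 := by
      intro h0
      have : Real.exp (-2 * g) = 1 := by linarith
      rw [Real.exp_eq_one_iff] at this
      exact h (by linarith)
    rw [show -(2 * g) = -2 * g by ring, div_mul_div_comm, mul_comm, div_self]
    exact mul_ne_zero h1 (by simpa using h)

lemma aux_omega_pos (g : ℝ) : 0 < omegaSel g := by
  have h := aux_omega g
  have hW0 : 0 ≤ ∫ y in (0:ℝ)..1, Real.exp (-(2 * g) * (1 - y)) :=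
    intervalIntegral.integral_nonneg zero_le_one (fun _ _ => (Real.exp_pos _).le)
  by_contra hn
  nlinarith

lemma aux_K (g N : ℝ) (h2 : 2 ≤ N) (hgN : 4 * g ^ 2 ≤ N) :
    0 ≤ 1 + Real.log N + Ksel g := by
  have hJ := aux_J (2 * g) N h2 (by linarith [mul_pow 2 g 2])
  have hw := aux_omega g
  have hp := aux_omega_pos g
  have hA : 0 ≤ ∫ y in (0:ℝ)..1, (-Real.log y) * Real.exp (-2 * g * y) := by
    refine intervalIntegral.integral_nonneg zero_le_one ?_
    rintro y ⟨hy0, hy1⟩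
    exact mul_nonneg (neg_nonneg.2 (Real.log_nonpos hy0 hy1)) (Real.exp_pos _).le
  have hs : ∫ y in (0:ℝ)..1, (-Real.log y) *
      (Real.exp (-2 * g * y) - Real.exp (-2 * g * (1 - y))) =
      (∫ y in (0:ℝ)..1, (-Real.log y) * Real.exp (-2 * g * y)) -
      ∫ y in (0:ℝ)..1, (-Real.log y) * Real.exp (-(2 * g) * (1 - y)) := by
    have i1 := aux_ii 0 1 (fun y => Real.exp (-2 * g * y)) (by fun_prop) 0
    have i2 := aux_ii 0 1 (fun y => Real.exp (-(2 * g) * (1 - y))) (by fun_prop) 0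
    simp only [sub_zero] at i1 i2
    rw [← intervalIntegral.integral_sub i1 i2]
    congr 1
    ext y
    rw [show -(2 * g) = -2 * g by ring]
    ring
  unfold Ksel
  rw [hs]
  have h3 := mul_le_mul_of_nonneg_left hJ hp.le
  have h4 := mul_nonneg hp.le hA
  have h5 : omegaSel g * ((1 + Real.log N) * ∫ y in (0:ℝ)..1, Real.exp (-(2 * g) * (1 - y)))
      = 1 + Real.log N := by
    rw [mul_left_comm, hw, mul_one]
  rw [mul_sub]
  linarith

lemma aux_omega_neg (g : ℝ) : omegaSel g = Real.exp (2 * g) * omegaSel (-g) := by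
  unfold omegaSel
  by_cases h : g = 0
  · simp [h]
  · have h1 : ∀ x : ℝ, x ≠ 0 → 1 - Real.exp x ≠ 0 := by
      intro x hx h0
      have : Real.exp x = 1 := by linarith
      rw [Real.exp_eq_one_iff] at this
      exact hx this
    have ha := h1 (-2 * g) (by simpa using h)
    have hb := h1 (-2 * -g) (by simpa using h)
    have he : Real.exp (2 * g) * Real.exp (-2 * g) = 1 := by
      rw [← Real.exp_add]; simp
    rw [if_neg h, if_neg (by simpa using h), ← mul_div_assoc, div_eq_div_iff ha hb]
    rw [show -2 * -g = 2 * g by ring]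
    linear_combination (-2 * g) * he

lemma aux_pair (g p q : ℝ) (hp : 0 ≤ p)
    (h : p * omegaSel g = q * omegaSel (-g)) : p * g + q * (-g) ≤ 0 := by
  have hpos := aux_omega_pos (-g)
  rw [aux_omega_neg g, ← mul_assoc] at h
  have hq : q = p * Real.exp (2 * g) := (mul_right_cancel₀ hpos.ne' h).symm
  subst hq
  have : 0 ≤ g * (Real.exp (2 * g) - 1) := by
    rcases le_total 0 g with h0 | h0
    · exact mul_nonneg h0 (by linarith [Real.one_le_exp (show 0 ≤ 2 * g by linarith)])
    · exact mul_nonneg_of_nonpos_of_nonpos h0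
        (by linarith [Real.exp_le_one_iff.2 (show 2 * g ≤ 0 by linarith)])
  nlinarith [mul_nonneg hp this]

/-- The average selection load of novel mutations is deleterious (nonpositive). -/
theorem dfe_mean_selection_nonpos {V : Type*} [Fintype V]
    (L N : ℕ) (hL : 1 ≤ L) (hN : 2 ≤ N)
    (θ : V → V → ℝ) (hθ : ∀ u v, 0 ≤ θ u v) (hθdiag : ∀ u, θ u u = 0)
    (γ : Fin L → V → V → ℝ) (hγ : ∀ j u v, γ j u v = -γ j v u)
    (η : Fin L → V → ℝ) (hη0 : ∀ j u, 0 ≤ η j u) (hη1 : ∀ j, ∑ u, η j u = 1)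
    (hdb : ∀ j u v,
      η j u * θ u v * omegaSel (γ j u v) = η j v * θ v u * omegaSel (γ j v u))
    (C : ℝ) (hC : ∀ j u v, |γ j u v| ≤ C) (hNC : 4 * C ^ 2 ≤ (N : ℝ))
    (Ω : Fin L → ℝ)
    (hΩ : ∀ j, Ω j = 1 + (2 / L) *
      ∑ u, ∑ v, η j u * θ u v * (1 + Real.log N + Ksel (γ j u v))) :
    (∑ j, ∑ u, ∑ v, (η j u / Ω j) * θ u v * γ j u v) ≤ 0 := by
  refine Finset.sum_nonpos fun j _ => ?_
  have hNr : (2:ℝ) ≤ N := by exact_mod_cast hN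
  have hΩ0 : 0 ≤ Ω j := by
    rw [hΩ j]
    have : 0 ≤ ∑ u, ∑ v, η j u * θ u v * (1 + Real.log N + Ksel (γ j u v)) := by
      refine Finset.sum_nonneg fun u _ => Finset.sum_nonneg fun v _ => ?_
      refine mul_nonneg (mul_nonneg (hη0 j u) (hθ u v)) (aux_K _ _ hNr ?_)
      have h1 := sq_le_sq' (by linarith [neg_abs_le (γ j u v), hC j u v])
        (le_trans (le_abs_self _) (hC j u v))
      linarith
    positivity
  have hS : ∑ u, ∑ v, η j u * θ u v * γ j u v ≤ 0 := by
    have h2 : (∑ u, ∑ v, η j u * θ u v * γ j u v) + ∑ u, ∑ v, η j u * θ u v * γ j u v ≤ 0 := by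
      nth_rewrite 2 [Finset.sum_comm]
      rw [← Finset.sum_add_distrib]
      refine Finset.sum_nonpos fun u _ => ?_
      rw [← Finset.sum_add_distrib]
      refine Finset.sum_nonpos fun v _ => ?_
      have hd := hdb j u v
      rw [hγ j v u] at hd ⊢
      exact aux_pair _ _ _ (mul_nonneg (hη0 j u) (hθ u v)) hd
    linarith
  have : ∑ u, ∑ v, (η j u / Ω j) * θ u v * γ j u v =
      (∑ u, ∑ v, η j u * θ u v * γ j u v) / Ω j := by
    simp only [Finset.sum_div]
    refine Finset.sum_congr rfl fun u _ => Finset.sum_congr rfl fun v _ => ?_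
    ring
  rw [this]
  exact div_nonpos_of_nonpos_of_nonneg hS hΩ0
end
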